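/- Let H be an atomic unit-cancellative monoid, G a finitely generated abelian group, G_0 ⊆ G a subset, and θ₁: H → B(G_0) a weak transfer homomorphism. Then there exist a finitely generated abelian group G*, a subset G_0* ⊆ G* such that the inclusion B(G_0*) ↪ F(G_0*) is a divisor theory, and a weak transfer homomorphism θ*: H → B(G_0*); moreover L(H) = L(B(G_0*)). -/

import Mathlib

open scoped Classical

/-- The monoid of zero-sum multisets over `G0 ⊆ G` (monoid of zero-sum sequences `B(G0)`),
realized as an additive submonoid of the free abelian monoid `F(G0)` of multisets. -/
def ZeroSum {G : Type*} [AddCommGroup G] (G0 : Set G) : AddSubmonoid (Multiset G) where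
  carrier := {S | (∀ x ∈ S, x ∈ G0) ∧ S.sum = 0}
  zero_mem' := ⟨fun x hx => absurd hx (Multiset.notMem_zero x), Multiset.sum_zero⟩
  add_mem' := by
    rintro a b ⟨ha1, ha2⟩ ⟨hb1, hb2⟩
    refine ⟨fun x hx => ?_, ?_⟩
    · rcases Multiset.mem_add.mp hx with h | h
      exacts [ha1 x h, hb1 x h]
    · rw [Multiset.sum_add, ha2, hb2, add_zero]

/-- The inclusion `B(G0) ↪ F(G0)` is a divisor theory: every `g ∈ G0` is the
greatest common divisor (pointwise minimum of multiplicities) of a finite nonempty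
set of zero-sum sequences. -/
def IsDivisorTheoryB {G : Type*} [AddCommGroup G] (G0 : Set G) : Prop :=
  ∀ g ∈ G0, ∃ (X : Finset (Multiset G)) (hX : X.Nonempty),
    (X : Set (Multiset G)) ⊆ (ZeroSum G0 : Set (Multiset G)) ∧
      ∀ h : G, X.inf' hX (fun B => Multiset.count h B) = Multiset.count h ({g} : Multiset G)

/-- A transfer homomorphism between reduced commutative (additive) monoids:
surjective, trivial kernel as a preimage of `0`, and factorizations lift. -/
def IsTransferHomAdd {M N : Type*} [AddCommMonoid M] [AddCommMonoid N] (θ : M →+ N) : Prop :=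
  Function.Surjective θ ∧ (∀ a : M, θ a = 0 → a = 0) ∧
    ∀ (u : M) (b c : N), θ u = b + c → ∃ v w : M, u = v + w ∧ θ v = b ∧ θ w = c

/-- An atom (irreducible element) of a (multiplicative) monoid. -/
def IsMulAtomM {M : Type*} [Monoid M] (u : M) : Prop :=
  ¬ IsUnit u ∧ ∀ b c : M, u = b * c → IsUnit b ∨ IsUnit c

/-- A monoid is atomic if every non-unit is a finite product of atoms. -/
def MulAtomic (M : Type*) [Monoid M] : Prop :=
  ∀ a : M, ¬ IsUnit a → ∃ l : List M, (∀ x ∈ l, IsMulAtomM x) ∧ l.prod = a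

/-- A monoid is unit-cancellative if `a = a·u` or `a = u·a` implies that `u` is a
unit. -/
def MulUnitCancellative (M : Type*) [Monoid M] : Prop :=
  ∀ a u : M, (a = a * u ∨ a = u * a) → IsUnit u

/-- The set of lengths of an element: `{0}` for units, and the set of all `n` such that
`a` is a product of `n` atoms otherwise. -/
def lengthSetM {M : Type*} [Monoid M] (a : M) : Set ℕ :=
  {n | (IsUnit a ∧ n = 0) ∨
    (¬ IsUnit a ∧ ∃ l : List M, l.length = n ∧ (∀ x ∈ l, IsMulAtomM x) ∧ l.prod = a)}

/-- The system of sets of lengths `L(M) = {L(a) : a ∈ M}`. -/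
def systemOfLengthsM (M : Type*) [Monoid M] : Set (Set ℕ) :=
  Set.range (lengthSetM (M := M))

/-- A weak transfer homomorphism: (T1) `B = B^× θ(H) B^×` and `θ⁻¹(B^×) = H^×`, and
(WT2) factorizations into atoms lift up to permutation and associates. -/
def IsWeakTransferHom {M N : Type*} [Monoid M] [Monoid N] (θ : M →* N) : Prop :=
  ((∀ b : N, ∃ (ε η : Nˣ) (a : M), b = ε * θ a * η) ∧
    (∀ a : M, IsUnit (θ a) ↔ IsUnit a)) ∧
  ∀ (a : M) (n : ℕ) (v : Fin n → N), (∀ i, IsMulAtomM (v i)) →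
    θ a = (List.ofFn v).prod →
    ∃ (u : Fin n → M) (τ : Equiv.Perm (Fin n)),
      (∀ i, IsMulAtomM (u i)) ∧ (List.ofFn u).prod = a ∧
      ∀ i, ∃ ε η : Nˣ, θ (u i) = ↑ε * v (τ i) * ↑η

/-- A finitely generated abelian group. -/
def IsFGAdd (G : Type*) [AddCommGroup G] : Prop :=
  ∃ S : Finset G, AddSubgroup.closure (S : Set G) = ⊤

open Multiset (replicate card sum_replicate)

section Transfer

theorem IsTransferHomAdd.comp {M N P : Type*} [AddCommMonoid M] [AddCommMonoid N]
    [AddCommMonoid P] {ψ : N →+ P} {φ : M →+ N} (hψ : IsTransferHomAdd ψ)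
    (hφ : IsTransferHomAdd φ) : IsTransferHomAdd (ψ.comp φ) := by
  refine ⟨hψ.1.comp hφ.1, fun a ha => hφ.2.1 _ (hψ.2.1 _ ha), fun u b c h => ?_⟩
  obtain ⟨v, w, hvw, rfl, rfl⟩ := hψ.2.2 _ _ _ h
  obtain ⟨x, y, rfl, rfl, rfl⟩ := hφ.2.2 _ _ _ hvw
  exact ⟨x, y, rfl, rfl, rfl⟩

theorem IsTransferHomAdd.id (M : Type*) [AddCommMonoid M] :
    IsTransferHomAdd (AddMonoidHom.id M) :=
  ⟨Function.surjective_id, fun _ h => h, fun _ b c h => ⟨b, c, h, rfl, rfl⟩⟩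

/-- Factorizations of the image under a transfer homomorphism lift, with any number of factors. -/
theorem IsTransferHomAdd.exists_ofFn_lift {M N : Type*} [AddCommMonoid M] [AddCommMonoid N]
    {φ : M →+ N} (hφ : IsTransferHomAdd φ) (n : ℕ) (v : Fin n → N) (a : M)
    (h : φ a = (List.ofFn v).sum) :
    ∃ w : Fin n → M, (List.ofFn w).sum = a ∧ ∀ i, φ (w i) = v i := by
  induction n generalizing a with
  | zero => exact ⟨Fin.elim0, by simpa using (hφ.2.1 a (by simpa using h)).symm, fun i => i.elim0⟩
  | succ n ih =>
    rw [List.ofFn_succ, List.sum_cons] at h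
    obtain ⟨b, c, rfl, hb, hc⟩ := hφ.2.2 _ _ _ h
    obtain ⟨w, rfl, hw⟩ := ih _ c hc
    refine ⟨Fin.cons b w, by simp [List.ofFn_succ], fun i => ?_⟩
    refine Fin.cases ?_ (fun j => ?_) i <;> simp [hb, hw]

/-- The composition of a weak transfer homomorphism with a transfer homomorphism between reduced
commutative monoids is a weak transfer homomorphism. -/
theorem IsWeakTransferHom.comp_transferHomAdd {H M N : Type*} [Monoid H] [AddCommMonoid M]
    [AddCommMonoid N] (hM : ∀ x : Multiplicative M, IsUnit x → x = 1)
    (hN : ∀ x : Multiplicative N, IsUnit x → x = 1)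
    {θ : H →* Multiplicative M} (hθ : IsWeakTransferHom θ) {φ : M →+ N}
    (hφ : IsTransferHomAdd φ) : IsWeakTransferHom (φ.toMultiplicative.comp θ) := by
  obtain ⟨⟨hsurj, hunit⟩, hlift⟩ := hθ
  have hφ_unit (x : Multiplicative M) (hx : IsUnit (φ.toMultiplicative x)) : x = 1 :=
    hφ.2.1 x.toAdd (hN _ hx)
  refine ⟨⟨fun b => ?_, fun a => ?_⟩, fun a n v hv hva => ?_⟩
  · obtain ⟨m, hm⟩ := hφ.1 b.toAdd
    obtain ⟨ε, η, a, ha⟩ := hsurj (Multiplicative.ofAdd m)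
    rw [hM _ ε.isUnit, hM _ η.isUnit, one_mul, mul_one] at ha
    refine ⟨1, 1, a, ?_⟩
    simp only [Units.val_one, one_mul, mul_one, MonoidHom.comp_apply, ← ha]
    exact congrArg Multiplicative.ofAdd hm.symm
  · refine ⟨fun h => (hunit a).1 ?_, fun h => h.map _⟩
    rw [hφ_unit _ h]
    exact isUnit_one
  · obtain ⟨w, hw, hwv⟩ := hφ.exists_ofFn_lift n v (θ a) hva
    have hatom (i : Fin n) : IsMulAtomM (M := Multiplicative M) (w i) := by
      refine ⟨fun h => (hv i).1 ?_, fun b c hbc => ?_⟩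
      · rw [← hwv i]
        exact h.map φ.toMultiplicative
      · have := (hv i).2 (φ.toMultiplicative b) (φ.toMultiplicative c)
          (by rw [← map_mul, ← hbc]; exact (hwv i).symm)
        refine this.imp (fun h => ?_) (fun h => ?_) <;> rw [hφ_unit _ h] <;> exact isUnit_one
    obtain ⟨u, τ, hu, hua, hε⟩ := hlift a n w hatom hw.symm
    refine ⟨u, τ, hu, hua, fun i => ⟨1, 1, ?_⟩⟩
    obtain ⟨ε, η, h⟩ := hε i
    rw [hM _ ε.isUnit, hM _ η.isUnit] at h
    have h : θ (u i) = w (τ i) := h.trans ((mul_one _).trans (one_mul _))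
    simp only [Units.val_one, one_mul, mul_one, MonoidHom.comp_apply, h]
    exact hwv (τ i)

/-- A weak transfer homomorphism to a reduced atomic commutative monoid maps atoms to atoms. -/
theorem IsWeakTransferHom.map_atom {H N : Type*} [Monoid H] [CommMonoid N]
    (hat : MulAtomic N) {θ : H →* N} (hθ : IsWeakTransferHom θ) {u : H} (hu : IsMulAtomM u) : IsMulAtomM (θ u) := by
  have hnu : ¬ IsUnit (θ u) := fun h => hu.1 ((hθ.1.2 u).1 h)
  obtain ⟨l, hl, hlu⟩ := hat _ hnu
  obtain ⟨w, τ, hw, hwu, -⟩ := hθ.2 u l.length l.get (fun i => hl _ (l.get_mem i))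
    (by rw [List.ofFn_get, hlu])
  match l, hl, hlu, w, hw, hwu with
  | [], _, hlu, _, _, _ => exact absurd (hlu ▸ isUnit_one) hnu
  | [x], hl, hlu, _, _, _ =>
    rw [← hlu, List.prod_singleton]
    exact hl x (by simp)
  | x :: y :: l, _, _, w, hw, hwu =>
    exfalso
    simp only [List.length_cons, List.ofFn_succ, List.prod_cons] at hwu
    rcases hu.2 _ _ hwu.symm with h | h
    · exact (hw _).1 h
    · have h1 := h.map θ
      rw [map_mul] at h1
      exact (hw _).1 ((hθ.1.2 _).1 (isUnit_of_mul_isUnit_left h1))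

theorem IsWeakTransferHom.lengthSetM_map {H N : Type*} [Monoid H] [CommMonoid N]
    (hat : MulAtomic N) {θ : H →* N} (hθ : IsWeakTransferHom θ) (a : H) : lengthSetM (θ a) = lengthSetM a := by
  ext n
  simp only [lengthSetM, Set.mem_ofPred_eq, hθ.1.2 a]
  refine or_congr_right (and_congr_right fun _ => ⟨?_, ?_⟩)
  · rintro ⟨l, rfl, hl, hla⟩
    obtain ⟨w, τ, hw, hwa, -⟩ := hθ.2 a l.length l.get (fun i => hl _ (l.get_mem i))
      (by rw [List.ofFn_get, hla])
    exact ⟨List.ofFn w, by simp, by simpa [List.mem_ofFn] using hw, hwa⟩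
  · rintro ⟨l, rfl, hl, rfl⟩
    refine ⟨l.map θ, by simp, ?_, (map_list_prod θ l).symm⟩
    simp only [List.mem_map, forall_exists_index, and_imp, forall_apply_eq_imp_iff₂]
    exact fun x hx => hθ.map_atom hat (hl x hx)

/-- A weak transfer homomorphism to a reduced atomic commutative monoid preserves the system of
sets of lengths. -/
theorem IsWeakTransferHom.systemOfLengthsM_eq {H N : Type*} [Monoid H] [CommMonoid N]
    (hN : ∀ x : N, IsUnit x → x = 1) (hat : MulAtomic N) {θ : H →* N}
    (hθ : IsWeakTransferHom θ) : systemOfLengthsM H = systemOfLengthsM N := by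
  have hsurj : Function.Surjective θ := fun b => by
    obtain ⟨ε, η, a, h⟩ := hθ.1.1 b
    rw [hN _ ε.isUnit, hN _ η.isUnit, one_mul, mul_one] at h
    exact ⟨a, h.symm⟩
  rw [systemOfLengthsM, systemOfLengthsM, ← hsurj.range_comp]
  exact congrArg Set.range (funext fun a => (hθ.lengthSetM_map hat a).symm)

end Transfer

section ZeroSum

variable {G : Type*} [AddCommGroup G]

theorem ZeroSum.isUnit_eq_one {G0 : Set G} (x : Multiplicative (ZeroSum G0)) (hx : IsUnit x) :
    x = 1 := by
  obtain ⟨y, hy⟩ := hx.exists_right_inv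
  have h : (x.toAdd : Multiset G) + (y.toAdd : Multiset G) = 0 :=
    congrArg (fun z : Multiplicative (ZeroSum G0) => (z.toAdd : Multiset G)) hy
  exact Subtype.ext (add_eq_zero.1 h).1

theorem ZeroSum.mulAtomic (G0 : Set G) : MulAtomic (Multiplicative (ZeroSum G0)) := by
  suffices h : ∀ (n : ℕ) (a : Multiplicative (ZeroSum G0)), card (a.toAdd : Multiset G) = n →
      ¬ IsUnit a → ∃ l : List (Multiplicative (ZeroSum G0)),
        (∀ x ∈ l, IsMulAtomM x) ∧ l.prod = a from fun a => h _ a rfl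
  intro n
  induction n using Nat.strong_induction_on with
  | _ n ih =>
    intro a hn ha
    by_cases hat : IsMulAtomM a
    · exact ⟨[a], by simpa using hat, by simp⟩
    · simp only [IsMulAtomM, not_and, not_forall, not_or] at hat
      obtain ⟨b, c, rfl, hb, hc⟩ := hat ha
      have hpos (x : Multiplicative (ZeroSum G0)) (hx : ¬ IsUnit x) :
          0 < card (x.toAdd : Multiset G) := by
        refine Multiset.card_pos.2 fun h => hx ?_
        have : x = 1 := Subtype.ext h
        rw [this]
        exact isUnit_one
      have hcard : card (b.toAdd : Multiset G) + card (c.toAdd : Multiset G) = n := by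
        rw [← hn, ← Multiset.card_add]
        rfl
      have h1 := hpos b hb
      have h2 := hpos c hc
      obtain ⟨l, hl, rfl⟩ := ih _ (by omega) b rfl hb
      obtain ⟨m, hm, rfl⟩ := ih _ (by omega) c rfl hc
      exact ⟨l ++ m, fun x hx => (List.mem_append.1 hx).elim (hl x) (hm x), List.prod_append⟩

theorem Multiset.exists_add_of_map_eq_add {α β : Type*} {f : α → β} {S : Multiset α}
    {T₁ T₂ : Multiset β} (h : S.map f = T₁ + T₂) :
    ∃ S₁ S₂, S = S₁ + S₂ ∧ S₁.map f = T₁ ∧ S₂.map f = T₂ := by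
  induction T₁ using Multiset.induction generalizing S with
  | empty => exact ⟨0, S, by simp, by simp, by simpa using h⟩
  | cons b T ih =>
    rw [Multiset.cons_add, ← Multiset.map_eq_cons] at h
    obtain ⟨a, ha, rfl, h⟩ := h
    obtain ⟨S₁, S₂, h12, rfl, rfl⟩ := ih h
    exact ⟨a ::ₘ S₁, S₂, by rw [Multiset.cons_add, ← h12, Multiset.cons_erase ha], by simp, rfl⟩

theorem Multiset.exists_refinement {α : Type*} {S R T₁ T₂ : Multiset α} (h : S + R = T₁ + T₂) :
    ∃ S₁ S₂ R₁ R₂, S = S₁ + S₂ ∧ R = R₁ + R₂ ∧ T₁ = S₁ + R₁ ∧ T₂ = S₂ + R₂ := by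
  have h' (a : α) : S.count a + R.count a = T₁.count a + T₂.count a := by
    rw [← Multiset.count_add, h, Multiset.count_add]
  refine ⟨S ∩ T₁, S - T₁, T₁ - S, R - (T₁ - S), ?_, ?_, ?_, ?_⟩ <;> ext a <;>
    simp only [Multiset.count_add, Multiset.count_inter, Multiset.count_sub] <;>
    have := h' a <;> omega

theorem Multiset.filter_ne_add_replicate {α : Type*} (S : Multiset α) (g : α) :
    S.filter (· ≠ g) + replicate (S.count g) g = S := by
  rw [← Multiset.filter_eq', add_comm]
  exact Multiset.filter_add_not _ S

theorem Multiset.filter_ne_add_replicate_of_notMem {α : Type*} {s : Set α} {g : α}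
    {T : Multiset α} (hT : ∀ x ∈ T, x ∈ s \ {g}) (k : ℕ) :
    (T + replicate k g).filter (· ≠ g) = T := by
  have h₁ : T.filter (· ≠ g) = T := Multiset.filter_eq_self.2 fun x hx => (hT x hx).2
  have h₂ : (replicate k g).filter (· ≠ g) = 0 :=
    Multiset.filter_eq_nil.2 fun x hx => not_not.2 (Multiset.eq_of_mem_replicate hx)
  rw [Multiset.filter_add, h₁, h₂, add_zero]

theorem Multiset.sum_filter_ne (S : Multiset G) (g : G) :
    (S.filter (· ≠ g)).sum + S.count g • g = S.sum := by
  conv_rhs => rw [← Multiset.filter_ne_add_replicate S g, Multiset.sum_add, sum_replicate]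

theorem Multiset.sum_filter_ne_mem {G0 : Set G} (S : Multiset G) (hS : ∀ x ∈ S, x ∈ G0) (g : G) :
    (S.filter (· ≠ g)).sum ∈ AddSubmonoid.closure (G0 \ {g}) :=
  AddSubmonoid.multiset_sum_mem _ _ fun x hx => AddSubmonoid.subset_closure
    ⟨hS x (Multiset.mem_of_mem_filter hx), (Multiset.mem_filter.1 hx).2⟩

theorem Multiset.neg_mem_closure {S : Multiset G} (hS : S.sum = 0) {y : G}
    (hy : y ∈ AddSubmonoid.closure {x | x ∈ S}) : -y ∈ AddSubmonoid.closure {x | x ∈ S} := by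
  induction hy using AddSubmonoid.closure_induction with
  | mem x hx =>
    obtain ⟨R, rfl⟩ := Multiset.exists_cons_of_mem hx
    rw [Multiset.sum_cons] at hS
    rw [neg_eq_of_add_eq_zero_right hS]
    exact AddSubmonoid.multiset_sum_mem _ _ fun z hz =>
      AddSubmonoid.subset_closure (Multiset.mem_cons_of_mem hz)
  | zero => simp
  | add x y _ _ hx hy =>
    rw [neg_add]
    exact add_mem hx hy

/-- If no positive multiple of `g` lies in the monoid generated by `G0 \ {g}`, then deleting `g`
and passing to the quotient by `g` is a transfer homomorphism. -/
theorem exists_transfer_quotient {G0 : Set G} {g : G} (hg : g ∈ G0)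
    (hn : ∀ n : ℕ, 0 < n → n • g ∉ AddSubmonoid.closure (G0 \ {g})) :
    ∃ φ : ZeroSum G0 →+
        ZeroSum ((QuotientAddGroup.mk : G → G ⧸ AddSubgroup.zmultiples g) '' (G0 \ {g})),
      IsTransferHomAdd φ ∧ ∀ S : ZeroSum G0, (φ S : Multiset (G ⧸ AddSubgroup.zmultiples g)) =
        ((S : Multiset G).filter (· ≠ g)).map QuotientAddGroup.mk := by
  let π : G →+ G ⧸ AddSubgroup.zmultiples g := QuotientAddGroup.mk' _
  have hπg : π g = 0 := (QuotientAddGroup.eq_zero_iff g).2 (AddSubgroup.mem_zmultiples g)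
  have hcompl (T : Multiset G) (hT : ∀ x ∈ T, x ∈ G0 \ {g}) (h0 : (T.map π).sum = 0) :
      ∃ k : ℕ, T + replicate k g ∈ ZeroSum G0 := by
    rw [← map_multiset_sum] at h0
    obtain ⟨z, hz⟩ := AddSubgroup.mem_zmultiples_iff.1 ((QuotientAddGroup.eq_zero_iff _).1 h0)
    have hz0 : z ≤ 0 := by
      by_contra! hpos
      lift z to ℕ using hpos.le
      refine hn z (by exact_mod_cast hpos) ?_
      rw [← natCast_zsmul, hz]
      exact AddSubmonoid.multiset_sum_mem _ _ fun x hx => AddSubmonoid.subset_closure (hT x hx)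
    obtain ⟨k, rfl⟩ := Int.exists_eq_neg_ofNat hz0
    refine ⟨k, fun x hx => ?_, ?_⟩
    · rcases Multiset.mem_add.1 hx with h | h
      · exact (hT x h).1
      · rwa [Multiset.eq_of_mem_replicate h]
    · rw [Multiset.sum_add, ← hz, sum_replicate, neg_smul, natCast_zsmul, neg_add_cancel]
  have hinj (m n : ℕ) (h : m • g = n • g) : m = n := by
    by_contra hne
    rcases Nat.lt_or_gt_of_ne hne with hlt | hlt
    · refine hn (n - m) (by omega) ?_
      rw [sub_nsmul g hlt.le, h, add_neg_cancel]
      exact zero_mem _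
    · refine hn (m - n) (by omega) ?_
      rw [sub_nsmul g hlt.le, h, add_neg_cancel]
      exact zero_mem _
  refine ⟨{ toFun := fun S => ⟨((S : Multiset G).filter (· ≠ g)).map π, ?_, ?_⟩
            map_zero' := ?_
            map_add' := ?_ }, ⟨?_, ?_, ?_⟩, fun S => rfl⟩
  · intro x hx
    obtain ⟨y, hy, rfl⟩ := Multiset.mem_map.1 hx
    exact ⟨y, ⟨S.2.1 y (Multiset.mem_of_mem_filter hy), (Multiset.mem_filter.1 hy).2⟩, rfl⟩
  · have := congrArg π (Multiset.sum_filter_ne (S : Multiset G) g)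
    rwa [S.2.2, map_add, map_nsmul, hπg, smul_zero, add_zero, map_zero, map_multiset_sum] at this
  · exact Subtype.ext (by simp)
  · exact fun S T => Subtype.ext (by simp [Multiset.filter_add])
  · rintro ⟨T, hT, hT0⟩
    have hT' := hT
    choose! f hf using hT'
    have hfT : (T.map f).map π = T := by
      rw [Multiset.map_map]
      exact (Multiset.map_congr rfl fun x hx => (hf x hx).2).trans (Multiset.map_id T)
    have hmem : ∀ x ∈ T.map f, x ∈ G0 \ {g} := by
      intro x hx
      obtain ⟨y, hy, rfl⟩ := Multiset.mem_map.1 hx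
      exact (hf y hy).1
    obtain ⟨k, hk⟩ := hcompl (T.map f) hmem (by rw [hfT, hT0])
    refine ⟨⟨_, hk⟩, Subtype.ext ?_⟩
    change ((T.map f + replicate k g).filter (· ≠ g)).map π = T
    rw [Multiset.filter_ne_add_replicate_of_notMem hmem, hfT]
  · intro S hS
    have h : ((S : Multiset G).filter (· ≠ g)).map π = 0 := congrArg Subtype.val hS
    rw [Multiset.map_eq_zero] at h
    have h0 := Multiset.sum_filter_ne (S : Multiset G) g
    rw [h, S.2.2, Multiset.sum_zero, zero_add] at h0
    have hc := hinj _ 0 (h0.trans (zero_nsmul g).symm)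
    have := Multiset.filter_ne_add_replicate (S : Multiset G) g
    rw [h, hc] at this
    exact Subtype.ext (by simpa using this.symm)
  · rintro S ⟨T₁, hT₁, hs₁⟩ ⟨T₂, hT₂, hs₂⟩ h
    have h : ((S : Multiset G).filter (· ≠ g)).map π = T₁ + T₂ := congrArg Subtype.val h
    obtain ⟨S₁, S₂, h12, rfl, rfl⟩ := Multiset.exists_add_of_map_eq_add h
    have hmem : ∀ x ∈ S₁ + S₂, x ∈ G0 \ {g} := fun x hx => by
      rw [← h12] at hx
      exact ⟨S.2.1 x (Multiset.mem_of_mem_filter hx), (Multiset.mem_filter.1 hx).2⟩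
    have hm₁ : ∀ x ∈ S₁, x ∈ G0 \ {g} := fun x hx => hmem x (Multiset.mem_add.2 (.inl hx))
    have hm₂ : ∀ x ∈ S₂, x ∈ G0 \ {g} := fun x hx => hmem x (Multiset.mem_add.2 (.inr hx))
    obtain ⟨k₁, hk₁⟩ := hcompl S₁ hm₁ hs₁
    obtain ⟨k₂, hk₂⟩ := hcompl S₂ hm₂ hs₂
    refine ⟨⟨_, hk₁⟩, ⟨_, hk₂⟩, Subtype.ext ?_, Subtype.ext ?_, Subtype.ext ?_⟩
    · have e₁ := hk₁.2
      have e₂ := hk₂.2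
      have e := Multiset.sum_filter_ne (S : Multiset G) g
      rw [S.2.2, h12] at e
      simp only [Multiset.sum_add, sum_replicate] at e₁ e₂ e
      have hc : (S : Multiset G).count g = k₁ + k₂ := by
        refine hinj _ _ (add_left_cancel (e.trans ?_))
        rw [add_nsmul, add_add_add_comm, e₁, e₂, add_zero]
      rw [← Multiset.filter_ne_add_replicate (S : Multiset G) g, h12, hc, Multiset.replicate_add]
      exact add_add_add_comm _ _ _ _
    · exact congrArg (Multiset.map π) (Multiset.filter_ne_add_replicate_of_notMem hm₁ k₁)
    · exact congrArg (Multiset.map π) (Multiset.filter_ne_add_replicate_of_notMem hm₂ k₂)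

/-- If the multiplicity of `g` is a multiple of `n` in each zero-sum sequence, then replacing
`n` copies of `g` by `n • g` is a transfer homomorphism. -/
theorem exists_transfer_nsmul {G0 : Set G} {g : G} (hg : g ∈ G0) {n : ℕ} (hn : 0 < n)
    (hdvd : ∀ S ∈ ZeroSum G0, n ∣ S.count g) :
    ∃ φ : ZeroSum G0 →+ ZeroSum (insert (n • g) (G0 \ {g})),
      IsTransferHomAdd φ ∧ ∀ S : ZeroSum G0, (φ S : Multiset G) =
        (S : Multiset G).filter (· ≠ g) + replicate ((S : Multiset G).count g / n) (n • g) := by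
  have hsum (A : Multiset G) (j : ℕ) :
      (A + replicate (n * j) g).sum = (A + replicate j (n • g)).sum := by
    simp only [Multiset.sum_add, sum_replicate, mul_nsmul]
  have hcount {A : Multiset G} (hA : ∀ x ∈ A, x ∈ G0 \ {g}) (k : ℕ) :
      (A + replicate k g).count g = k := by
    rw [Multiset.count_add, Multiset.count_replicate_self,
      Multiset.count_eq_zero_of_notMem fun h => (hA g h).2 rfl, zero_add]
  have hmk {A : Multiset G} (hA : ∀ x ∈ A, x ∈ G0 \ {g}) {j : ℕ}
      (h : (A + replicate j (n • g)).sum = 0) : A + replicate (n * j) g ∈ ZeroSum G0 := by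
    refine ⟨fun x hx => ?_, (hsum A j).trans h⟩
    rcases Multiset.mem_add.1 hx with h | h
    · exact (hA x h).1
    · rwa [Multiset.eq_of_mem_replicate h]
  have hval {A : Multiset G} (hA : ∀ x ∈ A, x ∈ G0 \ {g}) (j : ℕ) :
      (A + replicate (n * j) g).filter (· ≠ g) +
        replicate ((A + replicate (n * j) g).count g / n) (n • g) = A + replicate j (n • g) := by
    rw [Multiset.filter_ne_add_replicate_of_notMem hA, hcount hA, Nat.mul_div_cancel_left _ hn]
  have hmem (S : ZeroSum G0) : ∀ x ∈ (S : Multiset G).filter (· ≠ g), x ∈ G0 \ {g} := fun x hx =>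
    ⟨S.2.1 x (Multiset.mem_of_mem_filter hx), (Multiset.mem_filter.1 hx).2⟩
  have hback (S : ZeroSum G0) : (S : Multiset G).filter (· ≠ g) +
      replicate (n * ((S : Multiset G).count g / n)) g = S := by
    rw [Nat.mul_div_cancel' (hdvd S S.2), Multiset.filter_ne_add_replicate]
  refine ⟨{ toFun := fun S => ⟨(S : Multiset G).filter (· ≠ g) +
              replicate ((S : Multiset G).count g / n) (n • g), ?_, ?_⟩
            map_zero' := ?_
            map_add' := ?_ }, ⟨?_, ?_, ?_⟩, fun S => rfl⟩
  · intro x hx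
    rcases Multiset.mem_add.1 hx with h | h
    · exact Or.inr (hmem S x h)
    · exact Or.inl (Multiset.eq_of_mem_replicate h)
  · rw [← hsum, hback, S.2.2]
  · exact Subtype.ext (by simp)
  · intro S T
    refine Subtype.ext ?_
    change ((S : Multiset G) + T).filter (· ≠ g) +
      replicate (((S : Multiset G) + T).count g / n) (n • g) = _ + _
    rw [Multiset.filter_add, Multiset.count_add, Nat.add_div_of_dvd_right (hdvd S S.2),
      Multiset.replicate_add]
    exact add_add_add_comm _ _ _ _
  · rintro ⟨T, hT, hT0⟩
    have hA : ∀ x ∈ T.filter (· ≠ n • g), x ∈ G0 \ {g} := fun x hx =>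
      (hT x (Multiset.mem_of_mem_filter hx)).resolve_left (Multiset.mem_filter.1 hx).2
    refine ⟨⟨T.filter (· ≠ n • g) + replicate (n * T.count (n • g)) g, hmk hA ?_⟩, Subtype.ext ?_⟩
    · rw [Multiset.filter_ne_add_replicate, hT0]
    · exact (hval hA _).trans (Multiset.filter_ne_add_replicate T (n • g))
  · intro S hS
    have h : (S : Multiset G).filter (· ≠ g) +
      replicate ((S : Multiset G).count g / n) (n • g) = 0 := congrArg Subtype.val hS
    obtain ⟨h1, h2⟩ := add_eq_zero.1 h
    have h3 : (S : Multiset G).count g / n = 0 := by simpa using congrArg card h2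
    refine Subtype.ext ?_
    rw [← hback S, h1, h3]
    simp
  · rintro S ⟨T₁, hT₁, hs₁⟩ ⟨T₂, hT₂, hs₂⟩ h
    have h : (S : Multiset G).filter (· ≠ g) +
      replicate ((S : Multiset G).count g / n) (n • g) = T₁ + T₂ := congrArg Subtype.val h
    obtain ⟨S₁, S₂, R₁, R₂, hS, hR, rfl, rfl⟩ := Multiset.exists_refinement h
    obtain ⟨k₁, -, rfl⟩ := Multiset.le_replicate_iff.1 (hR ▸ Multiset.le_add_right R₁ R₂)
    obtain ⟨k₂, -, rfl⟩ := Multiset.le_replicate_iff.1 (hR ▸ Multiset.le_add_left R₂ _)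
    have hm := hmem S
    rw [hS] at hm
    have hm₁ : ∀ x ∈ S₁, x ∈ G0 \ {g} := fun x hx => hm x (Multiset.mem_add.2 (.inl hx))
    have hm₂ : ∀ x ∈ S₂, x ∈ G0 \ {g} := fun x hx => hm x (Multiset.mem_add.2 (.inr hx))
    refine ⟨⟨_, hmk hm₁ hs₁⟩, ⟨_, hmk hm₂ hs₂⟩, Subtype.ext ?_, Subtype.ext (hval hm₁ k₁),
      Subtype.ext (hval hm₂ k₂)⟩
    have hc : (S : Multiset G).count g / n = k₁ + k₂ := by simpa using congrArg card hR
    rw [← hback S, hS, hc, mul_add, Multiset.replicate_add]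
    exact add_add_add_comm _ _ _ _

/-- If every `g ∈ G0` lies in the monoid generated by `G0 \ {g}`, and this monoid contains the
negatives of all elements of `G0`, then `B(G0) ↪ F(G0)` is a divisor theory. -/
theorem isDivisorTheoryB_of_neg_mem {G0 : Set G}
    (h : ∀ g ∈ G0, ∀ x ∈ G0, -x ∈ AddSubmonoid.closure (G0 \ {g})) : IsDivisorTheoryB G0 := by
  intro g hg
  have key : ∀ y ∈ G0, ∃ T : Multiset G, (∀ x ∈ T, x ∈ G0 \ {y}) ∧ g ::ₘ T ∈ ZeroSum G0 := by
    intro y hy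
    obtain ⟨T, hT, hs⟩ := AddSubmonoid.exists_multiset_of_mem_closure (h y hy g hg)
    refine ⟨T, hT, fun x hx => ?_, by rw [Multiset.sum_cons, hs, add_neg_cancel]⟩
    rcases Multiset.mem_cons.1 hx with rfl | hx
    exacts [hg, (hT x hx).1]
  choose! T hT hT0 using key
  have hcount {y : G} (hy : y ∈ G0) : (T y).count y = 0 :=
    Multiset.count_eq_zero_of_notMem fun hx => (hT y hy y hx).2 rfl
  have hsub : ∀ y ∈ insert g (T g).toFinset, y ∈ G0 := by
    intro y hy
    rcases Finset.mem_insert.1 hy with rfl | hy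
    exacts [hg, (hT g hg y (Multiset.mem_toFinset.1 hy)).1]
  refine ⟨(insert g (T g).toFinset).image fun y => g ::ₘ T y, by simp, ?_, fun y => ?_⟩
  · intro B hB
    obtain ⟨y, hy, rfl⟩ := Finset.mem_image.1 (Finset.mem_coe.1 hB)
    exact hT0 y (hsub y hy)
  · have hmem {y : G} (hy : y ∈ insert g (T g).toFinset) :=
      Finset.mem_image_of_mem (fun y => g ::ₘ T y) hy
    refine le_antisymm ?_ (Finset.le_inf' _ _ fun B hB => ?_)
    · rcases eq_or_ne y g with rfl | hy
      · refine (Finset.inf'_le _ (hmem (Finset.mem_insert_self _ _))).trans ?_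
        simp [hcount hg]
      · by_cases hyT : y ∈ T g
        · have hy' : y ∈ insert g (T g).toFinset :=
            Finset.mem_insert_of_mem (Multiset.mem_toFinset.2 hyT)
          refine (Finset.inf'_le _ (hmem hy')).trans ?_
          simp [hcount (hsub y hy'), Multiset.count_cons_of_ne hy]
        · refine (Finset.inf'_le _ (hmem (Finset.mem_insert_self _ _))).trans ?_
          simp [hyT, Multiset.count_cons_of_ne hy]
    · obtain ⟨z, -, rfl⟩ := Finset.mem_image.1 hB
      exact Multiset.count_le_of_le _ (Multiset.singleton_le.2 (Multiset.mem_cons_self _ _))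

end ZeroSum

theorem isFGAdd_iff {G : Type*} [AddCommGroup G] : IsFGAdd G ↔ AddGroup.FG G :=
  AddGroup.fg_iff'.trans ⟨fun ⟨_, S, _, h⟩ => ⟨S, h⟩, fun ⟨S, h⟩ => ⟨_, S, rfl, h⟩⟩ |>.symm

/-- A zero-sum sequence whose support generates `G0` can be transported along a transfer
homomorphism to a set `Gs` for which `B(Gs) ↪ F(Gs)` is a divisor theory. -/
theorem exists_transfer_isDivisorTheoryB.{v} (m : ℕ) {G : Type v} [AddCommGroup G]
    (hfg : IsFGAdd G) (G0 : Set G) (S : ZeroSum G0) (hcard : card (S : Multiset G) = m)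
    (hS : G0 ⊆ AddSubmonoid.closure {x | x ∈ (S : Multiset G)}) :
    ∃ (Gs : Type v) (_ : AddCommGroup Gs) (G0s : Set Gs), IsFGAdd Gs ∧ IsDivisorTheoryB G0s ∧
      ∃ φ : ZeroSum G0 →+ ZeroSum G0s, IsTransferHomAdd φ := by
  induction m using Nat.strong_induction_on generalizing G with
  | _ m ih =>
  have hle : AddSubmonoid.closure G0 ≤ AddSubmonoid.closure {x | x ∈ (S : Multiset G)} :=
    AddSubmonoid.closure_le.2 hS
  have hge : AddSubmonoid.closure {x | x ∈ (S : Multiset G)} ≤ AddSubmonoid.closure G0 :=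
    AddSubmonoid.closure_mono S.2.1
  have hnegG (y : G) (hy : y ∈ AddSubmonoid.closure G0) : -y ∈ AddSubmonoid.closure G0 :=
    hge (Multiset.neg_mem_closure S.2.2 (hle hy))
  -- if a positive multiple of `g` lies in `[G0 \ {g}]`, then `[G0 \ {g}]` is a group
  have hneg {g : G} {n : ℕ} (hn : 0 < n) (hng : n • g ∈ AddSubmonoid.closure (G0 \ {g})) (y : G)
      (hy : y ∈ AddSubmonoid.closure (G0 \ {g})) : -y ∈ AddSubmonoid.closure (G0 \ {g}) := by
    have hmul (z : G) (hz : z ∈ AddSubmonoid.closure G0) :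
        n • z ∈ AddSubmonoid.closure (G0 \ {g}) := by
      induction hz using AddSubmonoid.closure_induction with
      | mem x hx =>
        by_cases hxg : x = g
        · rwa [hxg]
        · exact nsmul_mem (AddSubmonoid.subset_closure (show x ∈ G0 \ {g} from ⟨hx, hxg⟩)) n
      | zero => rw [smul_zero]; exact zero_mem _
      | add x y _ _ hx hy => rw [smul_add]; exact add_mem hx hy
    obtain ⟨k, rfl⟩ := Nat.exists_eq_add_of_lt hn
    have := add_mem (hmul (-y) (hnegG y (AddSubmonoid.closure_mono Set.sdiff_subset hy)))
      (nsmul_mem hy k)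
    rwa [zero_add, smul_neg, succ_nsmul, neg_add, add_right_comm, neg_add_cancel, zero_add] at this
  by_cases hall : ∀ g ∈ G0, g ∈ AddSubmonoid.closure (G0 \ {g})
  · refine ⟨G, inferInstance, G0, hfg, isDivisorTheoryB_of_neg_mem fun g hg x hx => ?_,
      AddMonoidHom.id _, IsTransferHomAdd.id _⟩
    refine hneg one_pos (by simpa using hall g hg) x ?_
    by_cases hxg : x = g
    · exact hxg ▸ hall x hx
    · exact AddSubmonoid.subset_closure (show x ∈ G0 \ {g} from ⟨hx, hxg⟩)
  push Not at hall
  obtain ⟨g, hg, hgn⟩ := hall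
  have hgS : g ∈ (S : Multiset G) := by
    by_contra hgS
    refine hgn (AddSubmonoid.closure_mono (fun x hx => ?_) (hS hg))
    exact ⟨S.2.1 x hx, fun h => hgS (h ▸ hx)⟩
  have hcount : 0 < (S : Multiset G).count g := Multiset.count_pos.2 hgS
  have hcardS := congrArg card (Multiset.filter_ne_add_replicate (S : Multiset G) g)
  rw [Multiset.card_add, Multiset.card_replicate, hcard] at hcardS
  by_cases hex : ∃ n : ℕ, 0 < n ∧ n • g ∈ AddSubmonoid.closure (G0 \ {g})
  · have hn := (Nat.find_spec hex).1
    have hng := (Nat.find_spec hex).2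
    have hmin (k : ℕ) (hk : 0 < k) (hkg : k • g ∈ AddSubmonoid.closure (G0 \ {g})) :
        Nat.find hex ≤ k := Nat.find_min' hex ⟨hk, hkg⟩
    generalize Nat.find hex = n at hn hng hmin
    have hn1 : n ≠ 1 := by
      rintro rfl
      exact hgn (by simpa using hng)
    have hdvd (c : ℕ) (hc : c • g ∈ AddSubmonoid.closure (G0 \ {g})) : n ∣ c := by
      by_contra hndvd
      have hpos : 0 < c % n := Nat.pos_of_ne_zero fun h => hndvd (Nat.dvd_of_mod_eq_zero h)
      refine (Nat.mod_lt c hn).not_ge (hmin _ hpos ?_)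
      have h := add_mem hc (hneg hn hng _ (nsmul_mem hng (c / n)))
      rwa [← mul_nsmul, ← Nat.mod_add_div c n, add_nsmul, Nat.mod_add_div, add_neg_cancel_right]
        at h
    have hdvdU (U : Multiset G) (hU : U ∈ ZeroSum G0) : n ∣ U.count g := by
      refine hdvd _ ?_
      have h := Multiset.sum_filter_ne U g
      rw [hU.2] at h
      rw [← neg_eq_of_add_eq_zero_right h]
      exact hneg hn hng _ (Multiset.sum_filter_ne_mem U hU.1 g)
    obtain ⟨φ, hφ, hφS⟩ := exists_transfer_nsmul hg hn hdvdU
    obtain ⟨k, hk⟩ := hdvdU S S.2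
    have hkpos : 0 < k := Nat.pos_of_mul_pos_left (hk ▸ hcount)
    have hSk : (φ S : Multiset G) = (S : Multiset G).filter (· ≠ g) + replicate k (n • g) := by
      rw [hφS, hk, Nat.mul_div_cancel_left _ hn]
    have hngS : n • g ∈ AddSubmonoid.closure {x | x ∈ (φ S : Multiset G)} := by
      refine AddSubmonoid.subset_closure ?_
      rw [Set.mem_ofPred_eq, hSk]
      exact Multiset.mem_add.2 (.inr (Multiset.mem_replicate.2 ⟨hkpos.ne', rfl⟩))
    obtain ⟨Gs, inst, G0s, h1, h2, ψ, hψ⟩ := ih (card (φ S : Multiset G)) (by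
      rw [hSk, Multiset.card_add, Multiset.card_replicate]
      have : 2 * k ≤ n * k := Nat.mul_le_mul_right k (by omega)
      omega) hfg _ (φ S) rfl (by
      rintro x (rfl | hx)
      · exact hngS
      · obtain ⟨T, hT, rfl⟩ := AddSubmonoid.exists_multiset_of_mem_closure (hS hx.1)
        have hTG : ∀ x ∈ T, x ∈ G0 := fun x hx => S.2.1 x (hT x hx)
        have hsum := Multiset.sum_filter_ne T g
        have hTn : n ∣ T.count g := by
          refine hdvd _ ?_
          rw [eq_neg_add_of_add_eq hsum]
          exact add_mem (hneg hn hng _ (Multiset.sum_filter_ne_mem T hTG g))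
            (AddSubmonoid.subset_closure hx)
        obtain ⟨c, hc⟩ := hTn
        rw [← hsum, hc, mul_nsmul]
        refine add_mem (AddSubmonoid.multiset_sum_mem _ _ fun y hy => ?_)
          (nsmul_mem hngS c)
        refine AddSubmonoid.subset_closure ?_
        rw [Set.mem_ofPred_eq, hSk]
        exact Multiset.mem_add.2 (.inl (Multiset.mem_filter.2
          ⟨hT y (Multiset.mem_of_mem_filter hy), (Multiset.mem_filter.1 hy).2⟩)))
    exact ⟨Gs, inst, G0s, h1, h2, ψ.comp φ, hψ.comp hφ⟩
  · push Not at hex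
    obtain ⟨φ, hφ, hφS⟩ := exists_transfer_quotient hg hex
    have hfg' : IsFGAdd (G ⧸ AddSubgroup.zmultiples g) := by
      have := isFGAdd_iff.1 hfg
      exact isFGAdd_iff.2 inferInstance
    obtain ⟨Gs, inst, G0s, h1, h2, ψ, hψ⟩ := ih (card (φ S : Multiset (G ⧸ AddSubgroup.zmultiples g))) (by
      rw [hφS, Multiset.card_map]
      omega) hfg' _ (φ S) rfl (by
      rintro _ ⟨x, hx, rfl⟩
      have hmap := AddSubmonoid.mem_map_of_mem
        (QuotientAddGroup.mk' (AddSubgroup.zmultiples g)) (hS hx.1)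
      rw [AddMonoidHom.map_mclosure] at hmap
      refine AddSubmonoid.closure_le.2 ?_ hmap
      rintro _ ⟨y, hy, rfl⟩
      by_cases hyg : y = g
      · rw [hyg, show QuotientAddGroup.mk' (AddSubgroup.zmultiples g) g = 0 from
          (QuotientAddGroup.eq_zero_iff g).2 (AddSubgroup.mem_zmultiples g)]
        exact zero_mem _
      · refine AddSubmonoid.subset_closure ?_
        rw [Set.mem_ofPred_eq, hφS]
        exact Multiset.mem_map.2 ⟨y, Multiset.mem_filter.2 ⟨hy, hyg⟩, rfl⟩)
    exact ⟨Gs, inst, G0s, h1, h2, ψ.comp φ, hψ.comp hφ⟩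

/-- In a finitely generated group, if every element of `G0` occurs in a zero-sum sequence, then
some zero-sum sequence has a support generating `G0`. -/
theorem exists_zeroSum_subset_closure {G : Type*} [AddCommGroup G] (hfg : IsFGAdd G) (G0 : Set G)
    (hG0 : ∀ g ∈ G0, ∃ U ∈ ZeroSum G0, g ∈ U) :
    ∃ S : ZeroSum G0, G0 ⊆ AddSubmonoid.closure {x | x ∈ (S : Multiset G)} := by
  have : Module.Finite ℤ G := Module.Finite.iff_addGroup_fg.2 (isFGAdd_iff.1 hfg)
  obtain ⟨T, hT, hspan⟩ := (Submodule.fg_span_iff_fg_span_finset_subset (R := ℤ) G0).1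
    (IsNoetherian.noetherian _)
  choose! U hU hgU using hG0
  have hmem : ∑ t ∈ T, U t ∈ ZeroSum G0 := sum_mem fun t ht => hU t (hT ht)
  refine ⟨⟨_, hmem⟩, fun x hx => ?_⟩
  have hx' : x ∈ Submodule.span ℤ (T : Set G) := hspan ▸ Submodule.subset_span hx
  clear hx
  induction hx' using Submodule.span_induction with
  | mem x hx =>
    exact AddSubmonoid.subset_closure (Multiset.mem_sum.2 ⟨x, hx, hgU x (hT hx)⟩)
  | zero => exact zero_mem _
  | add x y _ _ hx hy => exact add_mem hx hy
  | smul z x _ hx =>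
    obtain ⟨k, rfl | rfl⟩ := z.eq_nat_or_neg
    · rw [natCast_zsmul]
      exact nsmul_mem hx k
    · rw [neg_smul, natCast_zsmul]
      exact Multiset.neg_mem_closure hmem.2 (nsmul_mem hx k)

/-- Elements of `G0` which do not occur in any zero-sum sequence can be discarded. -/
theorem ZeroSum.setOf_mem_eq {G : Type*} [AddCommGroup G] (G0 : Set G) :
    ZeroSum {g | ∃ U ∈ ZeroSum G0, g ∈ U} = ZeroSum G0 := by
  ext U
  refine ⟨fun hU => ⟨fun x hx => ?_, hU.2⟩, fun hU => ⟨fun x hx => ⟨U, hU, hx⟩, hU.2⟩⟩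
  obtain ⟨V, hV, hxV⟩ := hU.1 x hx
  exact hV.1 x hxV

/-- Let `H` be an atomic unit-cancellative monoid, `G` a finitely
generated abelian group, `G0 ⊆ G`, and `θ₁ : H → B(G0)` a weak transfer homomorphism.
Then there exist a finitely generated abelian group `G*`, a subset `G₀* ⊆ G*` such that
`B(G₀*) ↪ F(G₀*)` is a divisor theory, and a weak transfer homomorphism
`θ* : H → B(G₀*)`; moreover `L(H) = L(B(G₀*))`. -/
theorem transfer_krull_fg.{u, v} {H : Type u} [Monoid H]
    (hatomic : MulAtomic H) (hunitcanc : MulUnitCancellative H)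
    {G : Type v} [AddCommGroup G] (hfg : IsFGAdd G) (G0 : Set G)
    (θ₁ : H →* Multiplicative ↥(ZeroSum G0)) (hθ₁ : IsWeakTransferHom θ₁) :
    ∃ (Gs : Type v) (instG : AddCommGroup Gs) (G0s : Set Gs),
      (@IsFGAdd Gs instG) ∧
      (@IsDivisorTheoryB Gs instG G0s) ∧
      ∃ θ : H →* Multiplicative ↥(@ZeroSum Gs instG G0s),
        IsWeakTransferHom θ ∧
        systemOfLengthsM H = systemOfLengthsM (Multiplicative ↥(@ZeroSum Gs instG G0s)) := by
  have hred := ZeroSum.setOf_mem_eq G0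
  have hocc : ∀ g ∈ {g | ∃ U ∈ ZeroSum G0, g ∈ U},
      ∃ U ∈ ZeroSum {g | ∃ U ∈ ZeroSum G0, g ∈ U}, g ∈ U := fun g hg => hred.symm ▸ hg
  obtain ⟨S, hS⟩ := exists_zeroSum_subset_closure hfg _ hocc
  obtain ⟨Gs, inst, G0s, hfgs, hdiv, φ, hφ⟩ :=
    exists_transfer_isDivisorTheoryB _ hfg _ S rfl hS
  have hφ' : ∃ φ : ZeroSum G0 →+ ZeroSum G0s, IsTransferHomAdd φ := by
    rw [← hred]
    exact ⟨φ, hφ⟩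
  obtain ⟨ψ, hψ⟩ := hφ'
  have hθ := hθ₁.comp_transferHomAdd ZeroSum.isUnit_eq_one ZeroSum.isUnit_eq_one hψ
  exact ⟨Gs, inst, G0s, hfgs, hdiv, _, hθ,
    hθ.systemOfLengthsM_eq ZeroSum.isUnit_eq_one (ZeroSum.mulAtomic G0s)⟩
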